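/- Let r be a natural number equal to the Krull dimension of the ring S/mS. If the top local cohomology module H^r_n(S/mS) (the r-th local cohomology of the S-module S/mS with respect to the ideal n) is Artinian as an R-module by restriction of scalars along φ, then the R-module S/mS has finite length. -/

import Mathlib

open IsLocalRing TensorProduct

universe u

section

open CategoryTheory CategoryTheory.Abelian Opposite

section ColimExt

variable {S : Type u} [CommRing S]

/-- The transition maps of the system of modules `Ext^i(X t, M)`, where `X` is an inverse system
of modules indexed by `ℕ`. -/
noncomputable def extTransition (X : ℕᵒᵖ ⥤ ModuleCat.{u} S) (i : ℕ) (M : ModuleCat.{u} S)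
    (a b : ℕ) (h : a ≤ b) : Ext (X.obj (op a)) M i →ₗ[S] Ext (X.obj (op b)) M i :=
  Ext.precompOfLinear (Ext.mk₀ (X.map (homOfLE h).op)) S M (zero_add i)

lemma extTransition_apply (X : ℕᵒᵖ ⥤ ModuleCat.{u} S) (i : ℕ) (M : ModuleCat.{u} S)
    (a b : ℕ) (h : a ≤ b) (e : Ext (X.obj (op a)) M i) :
    extTransition X i M a b h e = (Ext.mk₀ (X.map (homOfLE h).op)).comp e (zero_add i) :=
  rfl

instance (X : ℕᵒᵖ ⥤ ModuleCat.{u} S) (i : ℕ) (M : ModuleCat.{u} S) :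
    DirectedSystem (fun t : ℕ => Ext (X.obj (op t)) M i)
      (fun a b h => extTransition X i M a b h) where
  map_self a x := by
    simp [extTransition_apply]
  map_map a b c hab hbc x := by
    have : (homOfLE (hab.trans hbc)).op = (homOfLE hbc).op ≫ (homOfLE hab).op := rfl
    simp [extTransition_apply, this]

/-- The direct limit of the modules `Ext^i(X t, M)`. -/
noncomputable abbrev ColimExt (X : ℕᵒᵖ ⥤ ModuleCat.{u} S) (i : ℕ) (M : ModuleCat.{u} S) : Type u :=
  Module.DirectLimit (fun t : ℕ => Ext (X.obj (op t)) M i) (extTransition X i M)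

namespace ColimExt

variable (X : ℕᵒᵖ ⥤ ModuleCat.{u} S) (i : ℕ)

/-- The class in the direct limit of an element of `Ext^i(X t, M)`. -/
noncomputable abbrev of (M : ModuleCat.{u} S) (t : ℕ) :
    Ext (X.obj (op t)) M i →ₗ[S] ColimExt X i M :=
  Module.DirectLimit.of S ℕ (fun t : ℕ => Ext (X.obj (op t)) M i) (extTransition X i M) t

variable {i}

lemma exists_of {M : ModuleCat.{u} S} (z : ColimExt X i M) : ∃ t e, of X i M t e = z :=
  Module.DirectLimit.exists_of z

lemma exists_of_eq_zero {M : ModuleCat.{u} S} {t : ℕ} {e : Ext (X.obj (op t)) M i}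
    (h : of X i M t e = 0) : ∃ t', ∃ h : t ≤ t', extTransition X i M t t' h e = 0 := by
  exact Module.DirectLimit.of.zero_exact h

lemma of_transition {M : ModuleCat.{u} S} {t t' : ℕ} (h : t ≤ t') (e : Ext (X.obj (op t)) M i) :
    of X i M t' (extTransition X i M t t' h e) = of X i M t e :=
  Module.DirectLimit.of_f

/-- Postcomposition with a class in `Ext^j(M, N)`. -/
noncomputable def postcomp {M N : ModuleCat.{u} S} {i j k : ℕ} (α : Ext M N j) (h : i + j = k) :
    ColimExt X i M →ₗ[S] ColimExt X k N :=
  Module.DirectLimit.map (fun _ => Ext.postcompOfLinear α S _ h) (by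
    intro a b hab
    ext e
    simp only [LinearMap.comp_apply, extTransition_apply, LinearMap.flip_apply,
      Ext.bilinearCompOfLinear_apply_apply]
    exact Ext.comp_assoc _ _ _ _ _ (by lia))

@[simp]
lemma postcomp_of {M N : ModuleCat.{u} S} {i j k : ℕ} (α : Ext M N j) (h : i + j = k) (t : ℕ)
    (e : Ext (X.obj (op t)) M i) :
    postcomp X α h (of X i M t e) = of X k N t (e.comp α h) :=
  Module.DirectLimit.map_apply_of _ _ _

lemma postcomp_comp_eq_zero {M N P : ModuleCat.{u} S} {i j k l m : ℕ} (α : Ext M N j)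
    (β : Ext N P l) (h : i + j = k) (h' : k + l = m) {q : ℕ} (hq : j + l = q)
    (hαβ : α.comp β hq = 0) (z : ColimExt X i M) : postcomp X β h' (postcomp X α h z) = 0 := by
  obtain ⟨t, e, rfl⟩ := exists_of X z
  rw [postcomp_of, postcomp_of, Ext.comp_assoc e α β h hq (by lia), hαβ]
  simp

lemma exact_postcomp {M N P : ModuleCat.{u} S} {i j k l m : ℕ} (α : Ext M N j)
    (β : Ext N P l) (h : i + j = k) (h' : k + l = m) {q : ℕ} (hq : j + l = q)
    (hαβ : α.comp β hq = 0)
    (H : ∀ (L : ModuleCat.{u} S) (e : Ext L N k), e.comp β h' = 0 →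
      ∃ d : Ext L M i, d.comp α h = e) :
    Function.Exact (postcomp X α h) (postcomp X β h') := by
  intro z
  refine ⟨fun hz => ?_, ?_⟩
  · obtain ⟨t, e, rfl⟩ := exists_of X z
    rw [postcomp_of] at hz
    obtain ⟨t', htt', h0⟩ := exists_of_eq_zero X hz
    obtain ⟨d, hd⟩ := H _ (extTransition X k N t t' htt' e) (by
      rw [extTransition_apply, Ext.comp_assoc _ _ _ _ h' (by lia)]
      exact h0)
    exact ⟨of X i M t' d, by rw [postcomp_of, hd, of_transition]⟩
  · rintro ⟨z, rfl⟩
    exact postcomp_comp_eq_zero X α β h h' hq hαβ z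

variable (i) in
/-- The map induced by a linear map. -/
noncomputable def map {M N : Type u} [AddCommGroup M] [Module S M] [AddCommGroup N] [Module S N]
    (f : M →ₗ[S] N) :
    ColimExt X i (ModuleCat.of S M) →ₗ[S] ColimExt X i (ModuleCat.of S N) :=
  postcomp X (Ext.mk₀ (ModuleCat.ofHom f)) (add_zero i)

section Exact

variable {M' M M'' : Type u} [AddCommGroup M'] [Module S M'] [AddCommGroup M] [Module S M]
  [AddCommGroup M''] [Module S M''] {f : M' →ₗ[S] M} {g : M →ₗ[S] M''}

@[simp]
lemma map_of (t : ℕ) (e : Ext (X.obj (op t)) (ModuleCat.of S M') i) :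
    map X i f (of X i _ t e) = of X i _ t (e.comp (Ext.mk₀ (ModuleCat.ofHom f)) (add_zero i)) :=
  postcomp_of _ _ _ _ _

lemma map_smul_id (s : S) : map X i (s • (LinearMap.id : M →ₗ[S] M)) = s • LinearMap.id := by
  refine LinearMap.ext fun z => ?_
  obtain ⟨t, e, rfl⟩ := exists_of X z
  have : ModuleCat.ofHom (s • (LinearMap.id : M →ₗ[S] M)) = s • 𝟙 _ := rfl
  rw [map_of, this, ← Ext.smul_eq_comp_mk₀]
  simp

lemma shortExact_of (hf : Function.Injective f) (hfg : Function.Exact f g)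
    (hg : Function.Surjective g) :
    (ShortComplex.mk (ModuleCat.ofHom f) (ModuleCat.ofHom g)
      (by ext x; exact hfg.apply_apply_eq_zero x)).ShortExact where
  exact := (ShortComplex.ShortExact.moduleCat_exact_iff_function_exact _).2 hfg
  mono_f := (ModuleCat.mono_iff_injective _).2 hf
  epi_g := (ModuleCat.epi_iff_surjective _).2 hg

lemma exact_map (hf : Function.Injective f) (hfg : Function.Exact f g)
    (hg : Function.Surjective g) : Function.Exact (map X i f) (map X i g) := by
  have hS := shortExact_of hf hfg hg
  have h0 : ModuleCat.ofHom f ≫ ModuleCat.ofHom g = 0 := by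
    ext x; exact hfg.apply_apply_eq_zero x
  exact exact_postcomp X (Ext.mk₀ (ModuleCat.ofHom f)) (Ext.mk₀ (ModuleCat.ofHom g)) (add_zero i)
    (add_zero i) (zero_add 0) (by rw [Ext.mk₀_comp_mk₀, h0, Ext.mk₀_zero])
    (fun L e he => Ext.covariant_sequence_exact₂ L hS e he)

lemma exists_connecting (hf : Function.Injective f) (hfg : Function.Exact f g)
    (hg : Function.Surjective g) (i : ℕ) :
    ∃ δ : ColimExt X i (ModuleCat.of S M'') →ₗ[S] ColimExt X (i + 1) (ModuleCat.of S M'),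
      Function.Exact (map X i g) δ ∧ Function.Exact δ (map X (i + 1) f) := by
  have hS := shortExact_of hf hfg hg
  exact ⟨postcomp X hS.extClass rfl,
    exact_postcomp X _ _ _ _ (zero_add 1) hS.comp_extClass
      (fun L e he => Ext.covariant_sequence_exact₃ L hS e rfl he),
    exact_postcomp X _ _ _ _ (add_zero 1) hS.extClass_comp
      (fun L e he => Ext.covariant_sequence_exact₁ L hS e he rfl)⟩

lemma subsingleton_of_injective [Module.Injective S M] :
    Subsingleton (ColimExt X (i + 1) (ModuleCat.of S M)) := by
  refine subsingleton_of_forall_eq 0 fun z => ?_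
  obtain ⟨t, e, rfl⟩ := exists_of X z
  have : Injective (ModuleCat.of S M) := Module.injective_object_of_injective_module S M
  rw [Ext.eq_zero_of_injective e, map_zero]

lemma subsingleton_of_subsingleton [Subsingleton M] :
    Subsingleton (ColimExt X i (ModuleCat.of S M)) := by
  refine subsingleton_of_forall_eq 0 fun z => ?_
  have h : map X i ((0 : S) • (LinearMap.id : M →ₗ[S] M)) = map X i ((1 : S) • LinearMap.id) := by
    congr 1
    exact Subsingleton.elim _ _
  rw [map_smul_id, map_smul_id] at h
  simpa using (LinearMap.congr_fun h z).symm

end Exact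

lemma smul_of_eq_zero {M : ModuleCat.{u} S} {t : ℕ} {s : S} (hs : s • 𝟙 (X.obj (op t)) = 0)
    (e : Ext (X.obj (op t)) M i) : s • of X i M t e = 0 := by
  have : s • e = 0 := by
    conv_lhs => rw [← Ext.mk₀_id_comp e, ← Ext.smul_comp, ← Ext.mk₀_smul, hs]
    simp
  rw [← map_smul, this, map_zero]

end ColimExt

end ColimExt

section PowTorsion

variable {S : Type u} [CommRing S] (I : Ideal S)
  (M : Type u) [AddCommGroup M] [Module S M]

/-- The submodule of elements killed by some power of the ideal `I`. -/
def powTorsion : Submodule S M where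
  carrier := {m | ∃ t : ℕ, ∀ s ∈ I ^ t, s • m = 0}
  zero_mem' := ⟨0, by simp⟩
  add_mem' := by
    rintro a b ⟨t, ht⟩ ⟨t', ht'⟩
    refine ⟨max t t', fun s hs => ?_⟩
    rw [smul_add, ht s (Ideal.pow_le_pow_right (le_max_left _ _) hs),
      ht' s (Ideal.pow_le_pow_right (le_max_right _ _) hs), add_zero]
  smul_mem' := by
    rintro c a ⟨t, ht⟩
    exact ⟨t, fun s hs => by rw [smul_comm, ht s hs, smul_zero]⟩

variable {M}

lemma mem_powTorsion {m : M} : m ∈ powTorsion I M ↔ ∃ t : ℕ, ∀ s ∈ I ^ t, s • m = 0 :=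
  Iff.rfl

lemma powTorsion_powTorsion : powTorsion I (powTorsion I M) = ⊤ := by
  refine eq_top_iff.2 fun m _ => ?_
  obtain ⟨t, ht⟩ := m.2
  exact ⟨t, fun s hs => Subtype.ext (ht s hs)⟩

lemma powTorsion_eq_top_of_surjective {N : Type u} [AddCommGroup N] [Module S N] {f : M →ₗ[S] N}
    (hf : Function.Surjective f) (hM : powTorsion I M = ⊤) : powTorsion I N = ⊤ := by
  refine eq_top_iff.2 fun n _ => ?_
  obtain ⟨m, rfl⟩ := hf n
  obtain ⟨t, ht⟩ := (hM ▸ Submodule.mem_top : m ∈ powTorsion I M)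
  exact ⟨t, fun s hs => by rw [← map_smul, ht s hs, map_zero]⟩

end PowTorsion

section LC

variable {S : Type u} [CommRing S] (I : Ideal S)

/-- The inverse system of the modules `S ⧸ I ^ t`. -/
noncomputable abbrev powSystem : ℕᵒᵖ ⥤ ModuleCat.{u} S :=
  localCohomology.ringModIdeals (localCohomology.idealPowersDiagram I)

/-- Local cohomology of `M`, as the direct limit of the modules `Ext^i(S ⧸ I ^ t, M)`. -/
noncomputable abbrev LC (i : ℕ) (M : Type u) [AddCommGroup M] [Module S M] : Type u :=
  ColimExt (powSystem I) i (ModuleCat.of S M)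

namespace LC

/-- The map on local cohomology induced by a linear map. -/
noncomputable abbrev map (i : ℕ) {M N : Type u} [AddCommGroup M] [Module S M] [AddCommGroup N]
    [Module S N] (f : M →ₗ[S] N) : LC I i M →ₗ[S] LC I i N :=
  ColimExt.map (powSystem I) i f

variable {M : Type u} [AddCommGroup M] [Module S M]

lemma powTorsion_eq_top (i : ℕ) : powTorsion I (LC I i M) = ⊤ := by
  refine eq_top_iff.2 fun z _ => ?_
  obtain ⟨t, e, rfl⟩ := ColimExt.exists_of _ z
  refine ⟨t, fun s hs => ColimExt.smul_of_eq_zero _ ?_ e⟩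
  ext y
  obtain ⟨y, rfl⟩ := Ideal.Quotient.mk_surjective y
  change (Ideal.Quotient.mk (I ^ t)) (s * y) = 0
  exact Ideal.Quotient.eq_zero_iff_mem.2 (Ideal.mul_mem_right _ _ hs)

/-- The value at `1` of a class in `Ext^0(S ⧸ I ^ t, M) = Hom(S ⧸ I ^ t, M)`. -/
noncomputable def evalOne (M : Type u) [AddCommGroup M] [Module S M] (t : ℕ) :
    Ext ((powSystem I).obj (op t)) (ModuleCat.of S M) 0 →ₗ[S] M where
  toFun e := (Ext.linearEquiv₀ (R := S) e).hom (Ideal.Quotient.mk (I ^ t) 1)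
  map_add' a b := by rw [map_add]; rfl
  map_smul' a b := by rw [map_smul]; rfl

lemma evalOne_mk₀ (t : ℕ) (f : (powSystem I).obj (op t) ⟶ ModuleCat.of S M) :
    evalOne I M t (Ext.mk₀ f) = f.hom (Ideal.Quotient.mk (I ^ t) 1) := by
  have : Ext.linearEquiv₀ (R := S) (Ext.mk₀ f) = f :=
    (Ext.linearEquiv₀ (R := S)).apply_symm_apply f
  change (Ext.linearEquiv₀ (R := S) (Ext.mk₀ f)).hom (Ideal.Quotient.mk (I ^ t) 1) = _
  rw [this]

/-- The map from zeroth local cohomology of `M` to `M`. -/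
noncomputable def eval (M : Type u) [AddCommGroup M] [Module S M] : LC I 0 M →ₗ[S] M :=
  Module.DirectLimit.lift S ℕ _ _ (evalOne I M) (by
    intro a b hab e
    obtain ⟨f, rfl⟩ := Ext.homEquiv₀.symm.surjective e
    rw [extTransition_apply]
    change evalOne I M b ((Ext.mk₀ _).comp (Ext.mk₀ f) _) = evalOne I M a (Ext.mk₀ f)
    rw [Ext.mk₀_comp_mk₀, evalOne_mk₀, evalOne_mk₀]
    rfl)

lemma eval_of_mk₀ (t : ℕ) (f : (powSystem I).obj (op t) ⟶ ModuleCat.of S M) :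
    eval I M (ColimExt.of _ 0 _ t (Ext.mk₀ f)) = f.hom (Ideal.Quotient.mk (I ^ t) 1) :=
  (Module.DirectLimit.lift_of _ _ _).trans (evalOne_mk₀ I t f)

lemma exists_of_mk₀ (z : LC I 0 M) :
    ∃ (t : ℕ) (f : (powSystem I).obj (op t) ⟶ ModuleCat.of S M),
      z = ColimExt.of _ 0 _ t (Ext.mk₀ f) := by
  obtain ⟨t, e, rfl⟩ := ColimExt.exists_of _ z
  obtain ⟨f, rfl⟩ := Ext.homEquiv₀.symm.surjective e
  exact ⟨t, f, rfl⟩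

lemma eval_injective : Function.Injective (eval I M) := by
  refine (injective_iff_map_eq_zero _).2 fun z hz => ?_
  obtain ⟨t, f, rfl⟩ := exists_of_mk₀ I z
  rw [eval_of_mk₀] at hz
  have : f = 0 := by
    ext y
    obtain ⟨y, rfl⟩ := Ideal.Quotient.mk_surjective y
    have h : Ideal.Quotient.mk (I ^ t) y = y • Ideal.Quotient.mk (I ^ t) 1 := by
      rw [← mul_one y, map_mul]; simp [Algebra.smul_def]
    change f.hom (Ideal.Quotient.mk (I ^ t) y) = 0
    rw [h]
    exact (f.hom.map_smul y _).trans (by rw [hz, smul_zero])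
  rw [this, Ext.mk₀_zero, map_zero]

lemma range_eval : LinearMap.range (eval I M) = powTorsion I M := by
  ext m
  constructor
  · rintro ⟨z, rfl⟩
    obtain ⟨t, ht⟩ : z ∈ powTorsion I (LC I 0 M) := by
      simp [powTorsion_eq_top]
    exact ⟨t, fun s hs => by rw [← map_smul, ht s hs, map_zero]⟩
  · rintro ⟨t, ht⟩
    let f : (S ⧸ I ^ t) →ₗ[S] M := Submodule.liftQ _ (LinearMap.toSpanSingleton S M m)
      fun s hs => by simpa using ht s hs
    refine ⟨ColimExt.of _ 0 _ t (Ext.mk₀ (ModuleCat.ofHom f)), ?_⟩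
    exact (eval_of_mk₀ I t (ModuleCat.ofHom f)).trans (one_smul S m)

lemma eval_map {N : Type u} [AddCommGroup N] [Module S N] (f : M →ₗ[S] N) (z : LC I 0 M) :
    eval I N (map I 0 f z) = f (eval I M z) := by
  obtain ⟨t, g, rfl⟩ := exists_of_mk₀ I z
  rw [eval_of_mk₀, ColimExt.map_of, Ext.mk₀_comp_mk₀, eval_of_mk₀]
  rfl

lemma map_zero_surjective_of_powTorsion_eq_top {N : Type u} [AddCommGroup N] [Module S N]
    {f : M →ₗ[S] N} (hf : Function.Surjective f) (hM : powTorsion I M = ⊤) :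
    Function.Surjective (map I 0 f) := by
  intro z
  obtain ⟨m, hm⟩ := hf (eval I N z)
  obtain ⟨w, rfl⟩ : m ∈ LinearMap.range (eval I M) := by simp [range_eval, hM]
  exact ⟨w, eval_injective I (by rw [eval_map, hm])⟩

end LC

end LC

section TorsionVanishing

variable {S : Type u} [CommRing S] (I : Ideal S)

lemma exists_pow_smul_apply_eq_zero {M N : Type u} [AddCommGroup M] [Module S M] [AddCommGroup N]
    [Module S N] [Module.Finite S N] (f : N →ₗ[S] M) (hM : powTorsion I M = ⊤) :
    ∃ t : ℕ, ∀ s ∈ I ^ t, ∀ n, s • f n = 0 := by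
  obtain ⟨G, hG⟩ := Module.Finite.fg_top (R := S) (M := N)
  have h : ∀ n, ∃ t : ℕ, ∀ s ∈ I ^ t, s • f n = 0 := fun n =>
    (hM ▸ Submodule.mem_top : f n ∈ powTorsion I M)
  choose t ht using h
  refine ⟨G.sup t, fun s hs n => ?_⟩
  have hn : n ∈ Submodule.span S (G : Set N) := hG ▸ Submodule.mem_top
  induction hn using Submodule.span_induction with
  | mem x hx => exact ht x s (Ideal.pow_le_pow_right (Finset.le_sup (f := t) hx) hs)
  | zero => simp
  | add x y _ _ hx hy => rw [map_add, smul_add, hx, hy, add_zero]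
  | smul c x _ hx => rw [map_smul, smul_comm, hx, smul_zero]

lemma injective_powTorsion [IsNoetherianRing S] (E : Type u) [AddCommGroup E] [Module S E]
    [Module.Injective S E] : Module.Injective S (powTorsion I E) := by
  refine Module.Baer.injective fun J g => ?_
  obtain ⟨t, ht⟩ := exists_pow_smul_apply_eq_zero I g (powTorsion_powTorsion I)
  obtain ⟨k, hk⟩ := I.exists_pow_inf_eq_pow_smul J
  set n := t + k
  let J' : Submodule S J := Submodule.comap J.subtype (I ^ n)
  have hJ' : J' ≤ LinearMap.ker ((powTorsion I E).subtype ∘ₗ g) := by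
    intro j hj
    have hj' : (j : S) ∈ I ^ n • ⊤ ⊓ J := ⟨by simpa [J'] using hj, j.2⟩
    rw [hk n (by lia), show n - k = t by lia] at hj'
    have hle : I ^ t • (I ^ k • ⊤ ⊓ J) ≤ Submodule.map J.subtype (LinearMap.ker g) := by
      refine Submodule.smul_le.2 fun s hs x hx => ⟨s • ⟨x, hx.2⟩, ?_, rfl⟩
      change g _ = 0
      rw [map_smul, ht s hs]
    obtain ⟨j₀, hj₀, h⟩ := hle hj'
    obtain rfl : j₀ = j := Subtype.ext h
    change ((g j₀ : powTorsion I E) : E) = 0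
    rw [show g j₀ = 0 from hj₀]; rfl
  obtain ⟨h, hh⟩ := Module.Injective.out (R := S) (Submodule.mapQ J' (I ^ n) J.subtype le_rfl)
    (by
      rw [← LinearMap.ker_eq_bot, Submodule.ker_mapQ]
      exact Submodule.mkQ_map_self J') (J'.liftQ _ hJ')
  refine ⟨(h ∘ₗ (I ^ n).mkQ).codRestrict _ fun s => ⟨n, fun a ha => ?_⟩, fun x hx => ?_⟩
  · have : (I ^ n).mkQ (a • s) = 0 :=
      (Submodule.Quotient.mk_eq_zero _).2 (Ideal.mul_mem_right _ _ ha)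
    rw [← map_smul, LinearMap.comp_apply, this, map_zero]
  · exact Subtype.ext (hh (J'.mkQ ⟨x, hx⟩))

lemma exists_injective_module (M : Type u) [AddCommGroup M] [Module S M] :
    ∃ (E : Type u) (_ : AddCommGroup E) (_ : Module S E) (f : M →ₗ[S] E),
      Module.Injective S E ∧ Function.Injective f := by
  let E := Injective.under (ModuleCat.of S M)
  have : Injective (ModuleCat.of S E) := inferInstanceAs (Injective E)
  exact ⟨E, inferInstance, inferInstance, (Injective.ι (ModuleCat.of S M)).hom,
    Module.injective_module_of_injective_object S E,
    (ModuleCat.mono_iff_injective _).1 inferInstance⟩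

namespace LC

/-- Higher local cohomology of torsion modules vanishes. -/
lemma subsingleton_of_powTorsion_eq_top [IsNoetherianRing S] (i : ℕ) (M : Type u) [AddCommGroup M]
    [Module S M] (hM : powTorsion I M = ⊤) : Subsingleton (LC I (i + 1) M) := by
  obtain ⟨E, _, _, f, hE, hf⟩ := exists_injective_module (S := S) M
  have := injective_powTorsion I E
  let f' : M →ₗ[S] powTorsion I E := f.codRestrict _ fun m => by
    obtain ⟨t, ht⟩ := (hM ▸ Submodule.mem_top : m ∈ powTorsion I M)
    exact ⟨t, fun s hs => by rw [← map_smul, ht s hs, map_zero]⟩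
  have hf' : Function.Injective f' := fun a b h => hf (congrArg Subtype.val h)
  have hQ : powTorsion I (powTorsion I E ⧸ LinearMap.range f') = ⊤ :=
    powTorsion_eq_top_of_surjective I (Submodule.mkQ_surjective _) (powTorsion_powTorsion I)
  have hex : Function.Exact f' (LinearMap.range f').mkQ := LinearMap.exact_map_mkQ_range f'
  obtain ⟨δ, h₁, h₂⟩ := ColimExt.exists_connecting (powSystem I) hf' hex
    (Submodule.mkQ_surjective _) i
  have hE' := ColimExt.subsingleton_of_injective (powSystem I) (i := i) (S := S)
    (M := powTorsion I E)
  refine subsingleton_of_forall_eq 0 fun z => ?_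
  obtain ⟨w, rfl⟩ := (h₂ z).1 (Subsingleton.elim _ _)
  cases i with
  | zero =>
    obtain ⟨v, rfl⟩ := map_zero_surjective_of_powTorsion_eq_top I (Submodule.mkQ_surjective _)
      (powTorsion_powTorsion I) w
    exact h₁.apply_apply_eq_zero v
  | succ i =>
    have := subsingleton_of_powTorsion_eq_top i _ hQ
    rw [Subsingleton.elim w 0, map_zero]

end LC

end TorsionVanishing

section LocalModules

variable {S : Type u} [CommRing S] [IsLocalRing S] {N : Type u} [AddCommGroup N] [Module S N]

lemma isNoetherian_iff_isArtinian_of_maximalIdeal_smul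
    (hN : ∀ s ∈ maximalIdeal S, ∀ n : N, s • n = 0) : IsNoetherian S N ↔ IsArtinian S N := by
  have h : Module.IsTorsionBySet S N (maximalIdeal S) := fun n s => hN s s.2 n
  let _ := h.module
  let _ : Field (S ⧸ maximalIdeal S) := Ideal.Quotient.field _
  have : IsSemisimpleModule S N :=
    (h.semilinearMap.isSemisimpleModule_iff_of_bijective Function.bijective_id).2 inferInstance
  exact IsSemisimpleModule.finite_tfae.out 1 2

lemma isArtinian_of_maximalIdeal_pow_smul [IsNoetherianRing S] [Module.Finite S N] (t : ℕ)
    (hN : ∀ s ∈ maximalIdeal S ^ t, ∀ n : N, s • n = 0) : IsArtinian S N := by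
  induction t generalizing N with
  | zero =>
    have : Subsingleton N := subsingleton_of_forall_eq 0 fun n => by
      simpa using hN 1 (by simp) n
    infer_instance
  | succ t ih =>
    let N' : Submodule S N := maximalIdeal S • ⊤
    have h1 : IsArtinian S N' := by
      refine ih fun s hs n => Subtype.ext ?_
      obtain ⟨n, hn⟩ := n
      change s • n = 0
      induction hn using Submodule.smul_induction_on' with
      | smul r hr n _ =>
        rw [← mul_smul]
        exact hN _ (pow_succ (maximalIdeal S) t ▸ Ideal.mul_mem_mul hs hr) _
      | add x _ y _ hx hy => rw [smul_add, hx, hy, add_zero]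
    have h2 : IsArtinian S (N ⧸ N') := by
      refine (isNoetherian_iff_isArtinian_of_maximalIdeal_smul fun s hs n => ?_).1 inferInstance
      obtain ⟨n, rfl⟩ := N'.mkQ_surjective n
      rw [← map_smul]
      exact (Submodule.Quotient.mk_eq_zero _).2 (Submodule.smul_mem_smul hs trivial)
    exact (isArtinian_iff_submodule_quotient N').2 ⟨h1, h2⟩

/-- A module all of whose elements are killed by a power of `x` is Artinian as soon as the kernel
of multiplication by `x` is. -/
lemma isArtinian_of_isArtinian_ker_smul {S : Type u} [CommRing S] {H : Type u} [AddCommGroup H]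
    [Module S H] (x : S) (hx : ∀ h : H, ∃ k : ℕ, x ^ k • h = 0)
    (hK : IsArtinian S (LinearMap.ker (LinearMap.lsmul S H x))) : IsArtinian S H := by
  set K := LinearMap.ker (LinearMap.lsmul S H x)
  rw [← monotone_stabilizes_iff_artinian]
  intro f
  have hf : ∀ {i j : ℕ}, i ≤ j → ∀ h, h ∈ (OrderDual.ofDual (f j)) → h ∈ OrderDual.ofDual (f i) :=
    fun hij h hh => f.monotone hij hh
  let A (i j : ℕ) : Submodule S K :=
    { carrier := {k | ∃ h ∈ OrderDual.ofDual (f i), x ^ j • h = k}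
      zero_mem' := ⟨0, zero_mem _, by simp⟩
      add_mem' := by
        rintro a b ⟨h, hh, e⟩ ⟨h', hh', e'⟩
        exact ⟨h + h', add_mem hh hh', by rw [smul_add, e, e']; rfl⟩
      smul_mem' := by
        rintro c a ⟨h, hh, e⟩
        exact ⟨c • h, Submodule.smul_mem _ _ hh, by rw [smul_comm, e]; rfl⟩ }
  have hA : ∀ {i i' j j' : ℕ}, i ≤ i' → j ≤ j' → A i' j' ≤ A i j := by
    rintro i i' j j' hi hj k ⟨h, hh, e⟩
    refine ⟨x ^ (j' - j) • h, Submodule.smul_mem _ _ (hf hi _ hh), ?_⟩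
    rw [← mul_smul, ← pow_add, show j + (j' - j) = j' by lia, e]
  have stab : ∀ g : ℕ → Submodule S K, (∀ a b, a ≤ b → g b ≤ g a) →
      ∃ n, ∀ m, n ≤ m → g n = g m := fun g hg =>
    monotone_stabilizes_iff_artinian.2 hK ⟨fun n => OrderDual.toDual (g n), fun a b h => hg a b h⟩
  obtain ⟨i₀, hi₀⟩ := stab (fun i => A i i) fun a b h => hA h h
  have hrow : ∀ j, ∃ n, ∀ m, n ≤ m → A n j = A m j := fun j =>
    stab (fun i => A i j) fun a b h => hA h le_rfl
  choose n hn using hrow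
  set N := max i₀ ((Finset.range i₀).sup n)
  have hN : ∀ j m, N ≤ m → A N j = A m j := by
    intro j m hm
    by_cases hj : j < i₀
    · have : n j ≤ N := (Finset.le_sup (f := n) (Finset.mem_range.2 hj)).trans (le_max_right _ _)
      rw [← hn j N this, hn j m (this.trans hm)]
    · push Not at hj
      have h0 : i₀ ≤ N := le_max_left _ _
      refine le_antisymm ?_ (hA hm le_rfl)
      calc A N j ≤ A i₀ i₀ := hA h0 hj
        _ = A (max m j) (max m j) := hi₀ _ (by lia)
        _ ≤ A m j := hA (le_max_left _ _) (le_max_right _ _)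
  refine ⟨N, fun m hm => le_antisymm (f.monotone hm) ?_⟩
  have key : ∀ k : ℕ, ∀ h ∈ OrderDual.ofDual (f N), x ^ k • h = 0 → h ∈ OrderDual.ofDual (f m) := by
    intro k
    induction k with
    | zero => intro h _ h0; rw [pow_zero, one_smul] at h0; rw [h0]; exact zero_mem _
    | succ k ih =>
      intro h hh h0
      have hk : x ^ k • h ∈ K := by
        change x • x ^ k • h = 0
        rwa [← mul_smul, ← pow_succ']
      have : (⟨x ^ k • h, hk⟩ : K) ∈ A N k := ⟨h, hh, rfl⟩
      rw [hN k m hm] at this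
      obtain ⟨h', hh', e⟩ := this
      have := ih (h - h') (sub_mem hh (hf hm _ hh')) (by rw [smul_sub, e, sub_self])
      simpa using add_mem this hh'
  intro h hh
  obtain ⟨k, hk⟩ := hx h
  exact key k h hh hk

lemma exists_isSMulRegular_of_powTorsion_eq_bot [IsNoetherianRing S] [Module.Finite S N]
    (hN : powTorsion (maximalIdeal S) N = ⊥) : ∃ x ∈ maximalIdeal S, IsSMulRegular N x := by
  by_contra! h
  have hsub : (maximalIdeal S : Set S) ⊆ ⋃ p ∈ associatedPrimes S N, (p : Set S) := by
    rw [biUnion_associatedPrimes_eq_compl_regular]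
    exact h
  obtain ⟨p, hp, hle⟩ := (Ideal.subset_union_prime_finite (associatedPrimes.finite S N) (f := id)
    ⊤ ⊤ fun p hp _ _ => hp.isPrime).1 hsub
  obtain ⟨hprime, n, hn⟩ := isAssociatedPrime_iff.1 hp
  have hn0 : n ∈ powTorsion (maximalIdeal S) N := ⟨1, fun s hs => by
    have : s ∈ p := hle (by simpa using hs)
    rwa [hn, Submodule.mem_colon_singleton, Submodule.mem_bot] at this⟩
  rw [hN, Submodule.mem_bot] at hn0
  exact hprime.ne_top (by rw [hn, hn0, Ideal.eq_top_iff_one, Submodule.mem_colon_singleton]; simp)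

lemma powTorsion_quotient_eq_bot {S : Type u} [CommRing S] [IsNoetherianRing S] (I : Ideal S)
    (M : Type u) [AddCommGroup M] [Module S M] : powTorsion I (M ⧸ powTorsion I M) = ⊥ := by
  refine eq_bot_iff.2 fun m hm => ?_
  obtain ⟨m, rfl⟩ := Submodule.mkQ_surjective _ m
  obtain ⟨t, ht⟩ := hm
  have hmem : ∀ s ∈ I ^ t, s • m ∈ powTorsion I M := fun s hs =>
    (Submodule.Quotient.mk_eq_zero _).1 (ht s hs)
  let g : ↥(I ^ t) →ₗ[S] powTorsion I M :=
    ((LinearMap.toSpanSingleton S M m).comp (I ^ t).subtype).codRestrict _ fun s => hmem s s.2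
  obtain ⟨t', ht'⟩ := exists_pow_smul_apply_eq_zero I g (powTorsion_powTorsion I)
  refine (Submodule.Quotient.mk_eq_zero _).2 ⟨t' + t, fun s hs => ?_⟩
  rw [pow_add] at hs
  refine Submodule.mul_induction_on hs (fun a ha b hb => ?_) fun a b ha hb => ?_
  · rw [mul_smul]
    exact congrArg Subtype.val (ht' a ha ⟨b, hb⟩)
  · rw [add_smul, ha, hb, add_zero]

end LocalModules

namespace LC

variable {S : Type u} [CommRing S] (I : Ideal S) {M : Type u} [AddCommGroup M] [Module S M]

lemma exists_pow_smul_eq_zero {x : S} (hx : x ∈ I) {i : ℕ} (z : LC I i M) :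
    ∃ k : ℕ, x ^ k • z = 0 := by
  obtain ⟨t, ht⟩ : z ∈ powTorsion I (LC I i M) := by simp [powTorsion_eq_top]
  exact ⟨t, ht _ (Ideal.pow_mem_pow hx t)⟩

lemma map_quotient_powTorsion_injective [IsNoetherianRing S] (i : ℕ) :
    Function.Injective (map I (i + 1) (powTorsion I M).mkQ) := by
  have := subsingleton_of_powTorsion_eq_top I i _ (powTorsion_powTorsion I (M := M))
  refine (injective_iff_map_eq_zero _).2 fun z hz => ?_
  obtain ⟨w, rfl⟩ := (ColimExt.exact_map (powSystem I) (i := i + 1)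
    (powTorsion I M).subtype_injective (LinearMap.exact_subtype_mkQ _)
    (Submodule.mkQ_surjective _) z).1 hz
  rw [Subsingleton.elim w 0, map_zero]

section Regular

open scoped Pointwise

variable {x : S}

lemma exact_smul_mkQ : Function.Exact (x • (LinearMap.id : M →ₗ[S] M))
    (x • (⊤ : Submodule S M)).mkQ := by
  intro m
  rw [Submodule.mkQ_apply, Submodule.Quotient.mk_eq_zero, Submodule.mem_smul_pointwise_iff_exists]
  simp

variable (hx : IsSMulRegular M x)
include hx

lemma exists_connecting_quotSMulTop (i : ℕ) :
    ∃ δ : LC I i (QuotSMulTop x M) →ₗ[S] LC I (i + 1) M, ∀ z, x • z = 0 ↔ ∃ w, δ w = z := by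
  obtain ⟨δ, -, h⟩ := ColimExt.exists_connecting (powSystem I) (f := x • LinearMap.id)
    (M' := M) (M := M) (fun _ _ h => hx h)
    (exact_smul_mkQ) (Submodule.mkQ_surjective _) i
  refine ⟨δ, fun z => ?_⟩
  have := h z
  rwa [ColimExt.map_smul_id] at this

lemma smul_surjective_of_subsingleton {i : ℕ} (h : Subsingleton (LC I i (QuotSMulTop x M)))
    (z : LC I i M) : ∃ w, x • w = z := by
  have h := (ColimExt.exact_map (powSystem I) (i := i) (f := x • LinearMap.id)
    (M' := M) (M := M) (fun _ _ h => hx h)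
    (exact_smul_mkQ) (Submodule.mkQ_surjective _) z).1 (Subsingleton.elim _ _)
  rwa [ColimExt.map_smul_id] at h

end Regular

variable [IsLocalRing S] [IsNoetherianRing S]

/-- Grothendieck's vanishing theorem. -/
lemma subsingleton_of_supportDim_lt (i : ℕ) (M : Type u) [AddCommGroup M] [Module S M]
    [Module.Finite S M] (hM : Module.supportDim S M < i) :
    Subsingleton (LC (maximalIdeal S) i M) := by
  induction i generalizing M with
  | zero =>
    have : Subsingleton M := by
      rw [← Module.supportDim_eq_bot_iff_subsingleton (R := S)]
      by_contra h
      obtain ⟨d, hd⟩ := WithBot.ne_bot_iff_exists.1 h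
      rw [← hd] at hM
      exact absurd (WithBot.coe_lt_coe.1 hM) (by simp)
    exact ColimExt.subsingleton_of_subsingleton _
  | succ i ih =>
    have hinj := map_quotient_powTorsion_injective (maximalIdeal S) (M := M) i
    refine @Function.Injective.subsingleton _ _ _ hinj ?_
    obtain ⟨x, hxm, hx⟩ := exists_isSMulRegular_of_powTorsion_eq_bot
      (powTorsion_quotient_eq_bot (maximalIdeal S) M)
    obtain ⟨δ, hδ⟩ := exists_connecting_quotSMulTop (maximalIdeal S) hx i
    have := ih (QuotSMulTop x (M ⧸ powTorsion (maximalIdeal S) M)) (by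
      have h1 := Module.supportDim_quotSMulTop_succ_eq_supportDim hx hxm
      have h2 := Module.supportDim_le_of_surjective (powTorsion (maximalIdeal S) M).mkQ
        (Submodule.mkQ_surjective _)
      rw [← h1] at h2
      have h3 := h2.trans_lt hM
      push_cast at h3
      exact lt_of_add_lt_add_right h3)
    refine subsingleton_of_forall_eq 0 fun z => ?_
    obtain ⟨k, hk⟩ := exists_pow_smul_eq_zero (maximalIdeal S) hxm z
    induction k generalizing z with
    | zero => simpa using hk
    | succ k ihk =>
      refine ihk z ?_
      rw [pow_succ', mul_smul] at hk
      obtain ⟨w, hw⟩ := (hδ _).1 hk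
      rw [← hw, Subsingleton.elim w 0, map_zero]

lemma isArtinian (i : ℕ) (M : Type u) [AddCommGroup M] [Module S M] [Module.Finite S M] :
    IsArtinian S (LC (maximalIdeal S) i M) := by
  induction i generalizing M with
  | zero =>
    obtain ⟨t, ht⟩ := exists_pow_smul_apply_eq_zero (maximalIdeal S) LinearMap.id
      (powTorsion_powTorsion (maximalIdeal S) (M := M))
    have := isArtinian_of_maximalIdeal_pow_smul t ht
    rw [← range_eval] at this
    exact isArtinian_of_linearEquiv (LinearEquiv.ofInjective _ (eval_injective _)).symm
  | succ i ih =>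
    have hinj := map_quotient_powTorsion_injective (maximalIdeal S) (M := M) i
    refine @isArtinian_of_injective _ _ _ _ _ _ _ _ _ hinj ?_
    obtain ⟨x, hxm, hx⟩ := exists_isSMulRegular_of_powTorsion_eq_bot
      (powTorsion_quotient_eq_bot (maximalIdeal S) M)
    obtain ⟨δ, hδ⟩ := exists_connecting_quotSMulTop (maximalIdeal S) hx i
    have := ih (QuotSMulTop x (M ⧸ powTorsion (maximalIdeal S) M))
    refine isArtinian_of_isArtinian_ker_smul x
      (exists_pow_smul_eq_zero (maximalIdeal S) hxm) ?_
    refine isArtinian_of_surjective _ (δ.codRestrict _ fun w => (hδ _).2 ⟨w, rfl⟩) ?_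
    rintro ⟨z, hz⟩
    obtain ⟨w, rfl⟩ := (hδ z).1 hz
    exact ⟨w, rfl⟩

lemma smul_surjective {i : ℕ} [Module.Finite S M] (hM : Module.supportDim S M ≤ i) {x : S}
    (hx : IsSMulRegular M x) (z : LC (maximalIdeal S) i M) : ∃ w, x • w = z :=
  smul_surjective_of_subsingleton _ hx (subsingleton_of_supportDim_lt i _
    (ENat.WithBot.add_one_le_natCast_iff.1
      ((Module.supportDim_quotSMulTop_succ_le_of_notMem_minimalPrimes
        fun _ => hx.notMem_of_mem_minimalPrimes).trans hM))) z

end LC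

section Primes

variable {S : Type u} [CommRing S]

lemma isSMulRegular_quotient_of_notMem {p : Ideal S} [p.IsPrime] {x : S} (hx : x ∉ p) :
    IsSMulRegular (S ⧸ p) x := by
  refine isSMulRegular_iff_right_eq_zero_of_smul.2 fun m hm => ?_
  rw [Algebra.smul_def, mul_eq_zero] at hm
  exact hm.resolve_left fun h => hx (Ideal.Quotient.eq_zero_iff_mem.1 h)

lemma ringKrullDim_quotient_add_one_le_of_lt {p P : Ideal S} [p.IsPrime] (h : p < P) :
    ringKrullDim (S ⧸ P) + 1 ≤ ringKrullDim (S ⧸ p) := by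
  obtain ⟨x, hxP, hxp⟩ := SetLike.exists_of_lt h
  have h1 := Module.supportDim_quotSMulTop_succ_le_of_notMem_minimalPrimes (M := S ⧸ p)
    fun _ => (isSMulRegular_quotient_of_notMem hxp).notMem_of_mem_minimalPrimes
  rw [Module.supportDim_quotient_eq_ringKrullDim] at h1
  refine le_trans ?_ h1
  rw [← Module.supportDim_quotient_eq_ringKrullDim]
  gcongr
  let f : (S ⧸ p) →ₗ[S] S ⧸ P := Submodule.factor h.le
  have hf : Function.Surjective f := Submodule.factor_surjective h.le
  refine Module.supportDim_le_of_surjective (Submodule.liftQ _ f ?_) ?_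
  · intro m hm
    obtain ⟨m, -, rfl⟩ := (Submodule.mem_smul_pointwise_iff_exists _ _ _).1 hm
    obtain ⟨s, rfl⟩ := Ideal.Quotient.mk_surjective m
    exact (map_smul f x _).trans (Ideal.Quotient.eq_zero_iff_mem.2 (Ideal.mul_mem_right _ _ hxP))
  · intro z
    obtain ⟨m, rfl⟩ := hf z
    exact ⟨Submodule.mkQ _ m, rfl⟩

lemma exists_prime_le_ringKrullDim_quotient {J : Ideal S} {n : ℕ} (h : n ≤ ringKrullDim (S ⧸ J)) :
    ∃ P : Ideal S, P.IsPrime ∧ J ≤ P ∧ n ≤ ringKrullDim (S ⧸ P) := by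
  rw [ringKrullDim_quotient] at h
  obtain ⟨l, hl⟩ := Order.le_krullDim_iff.1 h
  refine ⟨l.head.1.asIdeal, l.head.1.isPrime, (PrimeSpectrum.mem_zeroLocus _ _).1 l.head.2, ?_⟩
  rw [ringKrullDim_quotient]
  refine Order.le_krullDim_iff.2 ⟨⟨l.length, fun i => ⟨(l i).1, ?_⟩, fun i => l.step i⟩, hl⟩
  exact (PrimeSpectrum.mem_zeroLocus _ _).2 (LTSeries.head_le l i)

variable [IsLocalRing S]

lemma ringKrullDim_quotient_maximalIdeal : ringKrullDim (S ⧸ maximalIdeal S) = 0 :=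
  ringKrullDim_eq_zero_of_isField
    ((Ideal.Quotient.maximal_ideal_iff_isField_quotient _).1 inferInstance)

lemma eq_maximalIdeal_of_ringKrullDim_eq_zero {p : Ideal S} [p.IsPrime]
    (h : ringKrullDim (S ⧸ p) = 0) : p = maximalIdeal S := by
  by_contra hne
  have := ringKrullDim_quotient_add_one_le_of_lt
    ((le_maximalIdeal Ideal.IsPrime.ne_top').lt_of_ne hne)
  rw [ringKrullDim_quotient_maximalIdeal, h] at this
  exact absurd this (by decide)

lemma exists_prime_ringKrullDim_quotient_of_notMem [IsNoetherianRing S] {n : ℕ} (hn : n ≠ 0)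
    {p : Ideal S} [p.IsPrime] (hp : ringKrullDim (S ⧸ p) = (n + 1 : ℕ)) {a : S} (ha : a ∉ p) :
    ∃ P : Ideal S, P.IsPrime ∧ p < P ∧ a ∉ P ∧ ringKrullDim (S ⧸ P) = n := by
  have hpm : p ≠ maximalIdeal S := by
    rintro rfl
    rw [ringKrullDim_quotient_maximalIdeal] at hp
    exact absurd hp (by exact_mod_cast (Nat.succ_ne_zero n).symm)
  set J := p ⊔ Ideal.span {a}
  let F : Set (Ideal S) := {p} ∪ {Q | Q ∈ J.minimalPrimes ∧ Q ≠ maximalIdeal S}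
  have hFfin : F.Finite := (Set.finite_singleton p).union
    (J.finite_minimalPrimes_of_isNoetherianRing.subset fun Q hQ => hQ.1)
  have hFprime : ∀ Q ∈ F, Q.IsPrime ∧ Q ≠ maximalIdeal S := by
    rintro Q (rfl | hQ)
    · exact ⟨inferInstance, hpm⟩
    · exact ⟨hQ.1.1.1, hQ.2⟩
  obtain ⟨x, hxm, hxF⟩ : ∃ x ∈ maximalIdeal S, ∀ Q ∈ F, x ∉ Q := by
    by_contra! h
    obtain ⟨Q, hQ, hle⟩ := (Ideal.subset_union_prime_finite hFfin (f := id) ⊤ ⊤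
      fun Q hQ _ _ => (hFprime Q hQ).1).1 (fun x hx => by
        obtain ⟨Q, hQ, hxQ⟩ := h x hx
        exact Set.mem_biUnion hQ hxQ)
    exact (hFprime Q hQ).2 (le_antisymm (le_maximalIdeal (hFprime Q hQ).1.ne_top) hle)
  have hxp : x ∉ p := hxF p (Or.inl rfl)
  have hdim := Module.supportDim_le_supportDim_quotSMulTop_succ (M := S ⧸ p) hxm
  rw [Module.supportDim_quotient_eq_ringKrullDim, hp] at hdim
  have hdim : (n : WithBot ℕ∞) ≤ Module.supportDim S (QuotSMulTop x (S ⧸ p)) := by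
    push_cast at hdim
    exact ENat.WithBot.add_le_add_one_right_iff.1 hdim
  rw [Module.supportDim_eq_ringKrullDim_quotient_annihilator] at hdim
  obtain ⟨P, hPprime, hann, hge⟩ := exists_prime_le_ringKrullDim_quotient hdim
  have hpP : p ≤ P := fun s hs => hann (Module.mem_annihilator.2 fun m => by
    obtain ⟨m, rfl⟩ := Submodule.mkQ_surjective _ m
    obtain ⟨m, rfl⟩ := Ideal.Quotient.mk_surjective m
    rw [← map_smul]
    have : s • Ideal.Quotient.mk p m = 0 :=
      Ideal.Quotient.eq_zero_iff_mem.2 (Ideal.mul_mem_right _ _ hs)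
    rw [this, map_zero])
  have hxP : x ∈ P := hann (Module.mem_annihilator.2 fun m => by
    obtain ⟨m, rfl⟩ := Submodule.mkQ_surjective _ m
    rw [← map_smul]
    exact (Submodule.Quotient.mk_eq_zero _).2 (Submodule.smul_mem_pointwise_smul _ _ _ trivial))
  have hlt : p < P := hpP.lt_of_ne (fun h => hxp (h ▸ hxP))
  have hle : ringKrullDim (S ⧸ P) + 1 ≤ (n + 1 : ℕ) :=
    hp ▸ ringKrullDim_quotient_add_one_le_of_lt hlt
  refine ⟨P, hPprime, hlt, fun haP => ?_, le_antisymm ?_ hge⟩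
  · obtain ⟨Q, hQ, hQP⟩ := Ideal.exists_minimalPrimes_le (I := J) (J := P)
      (sup_le hpP ((Ideal.span_singleton_le_iff_mem _).2 haP))
    have hQprime : Q.IsPrime := hQ.1.1
    have hJQ : J ≤ Q := hQ.1.2
    have hQm : Q ≠ maximalIdeal S := by
      rintro rfl
      have : P = maximalIdeal S := le_antisymm (le_maximalIdeal hPprime.ne_top) hQP
      rw [this, ringKrullDim_quotient_maximalIdeal] at hge
      exact hn (by simpa using (by exact_mod_cast hge : n ≤ 0))
    have hpQ : p < Q := (le_sup_left.trans hJQ).lt_of_ne fun h =>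
      ha (h ▸ hJQ (Ideal.mem_sup_right (Ideal.mem_span_singleton_self a)))
    have hQP' : Q < P := hQP.lt_of_ne fun h => hxF Q (Or.inr ⟨hQ, hQm⟩) (h ▸ hxP)
    have h1 := ringKrullDim_quotient_add_one_le_of_lt hpQ
    have h2 := ringKrullDim_quotient_add_one_le_of_lt hQP'
    rw [hp] at h1
    have h3 : (n : WithBot ℕ∞) + 1 + 1 ≤ (n + 1 : ℕ) := by
      refine le_trans ?_ h1
      gcongr
      refine le_trans ?_ h2
      gcongr
    have h4 : n + 1 + 1 ≤ n + 1 := by exact_mod_cast h3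
    lia
  · push_cast at hle
    exact ENat.WithBot.add_le_add_one_right_iff.1 hle

end Primes

namespace LC

variable {S : Type u} [CommRing S]

lemma smul_eq_zero_of_forall {I : Ideal S} {M : Type u} [AddCommGroup M] [Module S M] {s : S}
    (hs : ∀ m : M, s • m = 0) {i : ℕ} (z : LC I i M) : s • z = 0 := by
  have h : s • (LinearMap.id : M →ₗ[S] M) = (0 : S) • LinearMap.id := by
    ext m
    simpa using hs m
  have h' := ColimExt.map_smul_id (powSystem I) (i := i) (M := M) s
  rw [h, ColimExt.map_smul_id] at h'
  simpa using (LinearMap.congr_fun h' z).symm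

lemma quotient_smul_eq_zero {P : Ideal S} {s : S} (hs : s ∈ P) (m : S ⧸ P) : s • m = 0 := by
  obtain ⟨m, rfl⟩ := Ideal.Quotient.mk_surjective m
  exact Ideal.Quotient.eq_zero_iff_mem.2 (Ideal.mul_mem_right _ _ hs)

lemma map_surjective {I : Ideal S} {M N : Type u} [AddCommGroup M] [Module S M] [AddCommGroup N]
    [Module S N] {f : M →ₗ[S] N} (hf : Function.Surjective f) {i : ℕ}
    (h : Subsingleton (LC I (i + 1) (LinearMap.ker f))) : Function.Surjective (map I i f) := by
  intro z
  obtain ⟨δ, hδ, -⟩ := ColimExt.exists_connecting (powSystem I)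
    (LinearMap.ker f).subtype_injective (LinearMap.exact_subtype_ker_map f) hf i
  exact (hδ z).1 (Subsingleton.elim _ _)

variable [IsLocalRing S] [IsNoetherianRing S]

lemma subsingleton_submodule_quotient_prime {n : ℕ} {p : Ideal S} [p.IsPrime]
    (hp : ringKrullDim (S ⧸ p) = n) (h : Subsingleton (LC (maximalIdeal S) n (S ⧸ p)))
    (N : Submodule S (S ⧸ p)) : Subsingleton (LC (maximalIdeal S) n N) := by
  obtain rfl | hN := eq_or_ne N ⊥
  · exact ColimExt.subsingleton_of_subsingleton _
  obtain ⟨m, hmN, hm⟩ := N.ne_bot_iff.1 hN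
  obtain ⟨a, rfl⟩ := Ideal.Quotient.mk_surjective m
  have hap : a ∉ p := fun h => hm (Ideal.Quotient.eq_zero_iff_mem.2 h)
  have hreg := isSMulRegular_quotient_of_notMem hap
  let f : (S ⧸ p) →ₗ[S] N := (a • LinearMap.id).codRestrict N fun m => by
    obtain ⟨s, rfl⟩ := Ideal.Quotient.mk_surjective m
    have : a • Ideal.Quotient.mk p s = s • Ideal.Quotient.mk p a := by
      rw [Algebra.smul_def, Algebra.smul_def, mul_comm]; rfl
    change a • Ideal.Quotient.mk p s ∈ N
    rw [this]
    exact N.smul_mem _ hmN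
  have hf : Function.Injective f := fun x y h => hreg (congrArg Subtype.val h)
  have hregN : IsSMulRegular N a := fun x y h => Subtype.ext (hreg (congrArg Subtype.val h))
  have h1 := Module.supportDim_quotSMulTop_succ_le_of_notMem_minimalPrimes (M := N)
    fun _ => hregN.notMem_of_mem_minimalPrimes
  have h2 := Module.supportDim_le_of_injective N.subtype N.subtype_injective
  rw [Module.supportDim_quotient_eq_ringKrullDim, hp] at h2
  have h3 : Module.supportDim S (N ⧸ LinearMap.range f) ≤
      Module.supportDim S (QuotSMulTop a N) := by
    refine Module.supportDim_le_of_surjective (Submodule.factor ?_) (Submodule.factor_surjective _)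
    intro x hx
    obtain ⟨x, -, rfl⟩ := (Submodule.mem_smul_pointwise_iff_exists _ _ _).1 hx
    exact ⟨x, rfl⟩
  have := subsingleton_of_supportDim_lt n (N ⧸ LinearMap.range f)
    (h3.trans_lt (ENat.WithBot.add_one_le_natCast_iff.1 (h1.trans h2)))
  refine subsingleton_of_forall_eq 0 fun z => ?_
  obtain ⟨w, rfl⟩ := (ColimExt.exact_map (powSystem (maximalIdeal S)) (i := n) hf
    (LinearMap.exact_map_mkQ_range f) (Submodule.mkQ_surjective _) z).1 (Subsingleton.elim _ _)
  rw [Subsingleton.elim w 0, map_zero]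

/-- Grothendieck's nonvanishing theorem for quotients by prime ideals. -/
theorem nontrivial_quotient_prime (n : ℕ) (p : Ideal S) [p.IsPrime]
    (hp : ringKrullDim (S ⧸ p) = n) : Nontrivial (LC (maximalIdeal S) n (S ⧸ p)) := by
  induction n generalizing p with
  | zero =>
    obtain rfl := eq_maximalIdeal_of_ringKrullDim_eq_zero hp
    have : (1 : S ⧸ maximalIdeal S) ∈ LinearMap.range (eval (maximalIdeal S) _) := by
      rw [range_eval]
      exact ⟨1, fun s hs => quotient_smul_eq_zero (by simpa using hs) _⟩
    obtain ⟨z, hz⟩ := this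
    refine nontrivial_of_ne z 0 ?_
    rintro rfl
    rw [map_zero] at hz
    exact zero_ne_one hz
  | succ n ih =>
    by_contra! h
    have hsurj : ∀ P : Ideal S, ∀ hP : p ≤ P, Function.Surjective
        (map (maximalIdeal S) n (Submodule.factor hP : (S ⧸ p) →ₗ[S] S ⧸ P)) := fun P hP =>
      map_surjective (Submodule.factor_surjective hP)
        (subsingleton_submodule_quotient_prime hp h _)
    obtain rfl | hn := eq_or_ne n 0
    · have hlt : p < maximalIdeal S := (le_maximalIdeal Ideal.IsPrime.ne_top').lt_of_ne (by
        rintro rfl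
        rw [ringKrullDim_quotient_maximalIdeal] at hp
        exact absurd hp (by decide))
      obtain ⟨x, hx, hxp⟩ := SetLike.exists_of_lt hlt
      have := ih (maximalIdeal S) ringKrullDim_quotient_maximalIdeal
      have : Subsingleton (LC (maximalIdeal S) 0 (S ⧸ p)) := by
        refine subsingleton_of_forall_eq 0 fun z => eval_injective _ ?_
        obtain ⟨k, hk⟩ := exists_pow_smul_eq_zero (maximalIdeal S) hx z
        rw [map_zero]
        refine (isSMulRegular_quotient_of_notMem hxp).pow k ?_
        simp only [smul_zero, ← map_smul, hk, map_zero]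
      exact not_subsingleton _ (hsurj _ hlt.le).subsingleton
    · have := isArtinian (S := S) n (S ⧸ p)
      let T := LC (maximalIdeal S) n (S ⧸ p)
      obtain ⟨-, ⟨a, ha, rfl⟩, hmin⟩ := IsArtinian.set_has_minimal
        {N : Submodule S T | ∃ a ∉ p, N = LinearMap.range (a • (LinearMap.id : T →ₗ[S] T))}
        ⟨_, 1, fun h => Ideal.IsPrime.ne_top' ((Ideal.eq_top_iff_one p).2 h), rfl⟩
      obtain ⟨P, hP, hlt, haP, hdim⟩ := exists_prime_ringKrullDim_quotient_of_notMem hn hp ha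
      obtain ⟨b, hbP, hbp⟩ := SetLike.exists_of_lt hlt
      have := ih P hdim
      obtain ⟨z, hz⟩ := exists_ne (0 : LC (maximalIdeal S) n (S ⧸ P))
      apply hz
      obtain ⟨w, rfl⟩ := smul_surjective
        (by rw [Module.supportDim_quotient_eq_ringKrullDim, hdim])
        (isSMulRegular_quotient_of_notMem haP) z
      obtain ⟨t, rfl⟩ := hsurj P hlt.le w
      have hle : LinearMap.range ((b * a) • (LinearMap.id : T →ₗ[S] T)) ≤
          LinearMap.range (a • (LinearMap.id : T →ₗ[S] T)) := by
        rintro _ ⟨t, rfl⟩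
        exact ⟨b • t, by simp [mul_smul, smul_comm b a]⟩
      have hmem : a • t ∈ LinearMap.range ((b * a) • (LinearMap.id : T →ₗ[S] T)) := by
        have := hmin _ ⟨b * a, fun h => (Ideal.IsPrime.mem_or_mem inferInstance h).elim hbp ha, rfl⟩
        rw [eq_of_le_of_not_lt hle this]
        exact ⟨t, rfl⟩
      obtain ⟨t', ht'⟩ := hmem
      rw [← map_smul, ← ht']
      simp only [LinearMap.smul_apply, LinearMap.id_apply, mul_smul]
      rw [map_smul, smul_eq_zero_of_forall (quotient_smul_eq_zero hbP)]

end LC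

section Comparison
variable {S : Type u} [CommRing S]

/-- The morphism of complexes obtained from a morphism of complexes in the opposite category. -/
noncomputable def HomologicalComplex.unopMap
    {K L : HomologicalComplex (ModuleCat.{u} S)ᵒᵖ (ComplexShape.down ℕ)} (φ : K ⟶ L) :
    L.unop ⟶ K.unop :=
  (HomologicalComplex.unopFunctor _ _).map φ.op

/-- The morphism of cochain complexes induced by a chain map. -/
noncomputable def ChainComplex.linearYonedaMap {K L : ChainComplex (ModuleCat.{u} S) ℕ} (φ : K ⟶ L)
    (Y : ModuleCat.{u} S) : L.linearYonedaObj S Y ⟶ K.linearYonedaObj S Y :=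
  HomologicalComplex.unopMap
    ((((linearYoneda S (ModuleCat.{u} S)).obj Y).rightOp.mapHomologicalComplex _).map φ)

open HomologicalComplex in
lemma HomologicalComplex.homologyUnop_inv_naturality
    {K L : HomologicalComplex (ModuleCat.{u} S)ᵒᵖ (ComplexShape.down ℕ)} (φ : K ⟶ L) (i : ℕ) :
    (homologyMap φ i).unop ≫ (K.homologyUnop i).inv =
      (L.homologyUnop i).inv ≫ homologyMap (unopMap φ) i := by
  refine (Iso.comp_inv_eq _).2 ?_
  have h := congrArg Quiver.Hom.unop (homologyOp_hom_naturality (unopMap φ) i)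
  have h' : (L.homologyUnop i).hom ≫ (homologyMap φ i).unop =
     homologyMap (unopMap φ) i ≫ (K.homologyUnop i).hom := h
  exact ((Category.assoc _ _ _).trans ((Iso.inv_comp_eq _).2 h'.symm)).symm

lemma CategoryTheory.ProjectiveResolution.isoExt_naturality
    {X X' Y : ModuleCat.{u} S} (P : ProjectiveResolution X)
    (P' : ProjectiveResolution X') {g : X' ⟶ X} (φ : ProjectiveResolution.Hom P' P g) (n : ℕ) :
    ((_root_.Ext S (ModuleCat.{u} S) n).map g.op).app Y ≫ (P'.isoExt n Y).hom =
      (P.isoExt n Y).hom ≫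
        HomologicalComplex.homologyMap (ChainComplex.linearYonedaMap φ.hom Y) n := by
  have h := ProjectiveResolution.isoLeftDerivedObj_inv_naturality g P' P φ.hom
    (by rw [φ.hom_f_zero_comp_π_f_zero]; simp)
    ((linearYoneda S (ModuleCat.{u} S)).obj Y).rightOp n
  have h' : ((_root_.Ext S (ModuleCat.{u} S) n).map g.op).app Y ≫
      (P'.isoLeftDerivedObj ((linearYoneda S (ModuleCat S)).obj Y).rightOp n).inv.unop =
    (P.isoLeftDerivedObj ((linearYoneda S (ModuleCat S)).obj Y).rightOp n).inv.unop ≫ _ :=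
    congrArg Quiver.Hom.unop h
  have h2 := HomologicalComplex.homologyUnop_inv_naturality
    ((((linearYoneda S (ModuleCat.{u} S)).obj Y).rightOp.mapHomologicalComplex _).map φ.hom) n
  refine (Category.assoc _ _ _).symm.trans ?_
  refine (congrArg (· ≫ _) h').trans ?_
  refine (Category.assoc _ _ _).trans ?_
  refine Eq.trans ?_ (Category.assoc _ _ _).symm
  exact congrArg (_ ≫ ·) h2

namespace CategoryTheory.ProjectiveResolution

variable {X Y : ModuleCat.{u} S} (P : ProjectiveResolution X)

lemma smul_extMk {n : ℕ} (s : S) (f : P.complex.X n ⟶ Y) (hf : P.complex.d (n + 1) n ≫ f = 0) :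
    s • P.extMk f (n + 1) rfl hf = P.extMk (s • f) (n + 1) rfl (by simp [hf]) := by
  rw [Ext.smul_eq_comp_mk₀, extMk_comp_mk₀]
  congr 1

/-- The class in `Ext` of a cocycle in the complex computing `Ext` from a projective resolution. -/
noncomputable def cyclesToExt (Y : ModuleCat.{u} S) (n : ℕ) :
    (P.complex.linearYonedaObj S Y).cycles n ⟶ ModuleCat.of S (Abelian.Ext X Y n) :=
  have hd (z : (P.complex.linearYonedaObj S Y).cycles n) : P.complex.d (n + 1) n ≫
      (show P.complex.X n ⟶ Y from (P.complex.linearYonedaObj S Y).iCycles n z) = 0 :=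
    congrArg (fun f => f.hom z) ((P.complex.linearYonedaObj S Y).iCycles_d n (n + 1))
  ModuleCat.ofHom
    { toFun := fun z => P.extMk (show P.complex.X n ⟶ Y from
        (P.complex.linearYonedaObj S Y).iCycles n z) (n + 1) rfl (hd z)
      map_add' := fun z w => by
        rw [add_extMk]
        congr 1
        exact map_add ((P.complex.linearYonedaObj S Y).iCycles n).hom z w
      map_smul' := fun s z => by
        rw [RingHom.id_apply, smul_extMk]
        congr 1
        exact map_smul ((P.complex.linearYonedaObj S Y).iCycles n).hom s z }

lemma cyclesToExt_apply (n : ℕ) (z : (P.complex.linearYonedaObj S Y).cycles n)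
    (f : P.complex.X n ⟶ Y) (hf : P.complex.d (n + 1) n ≫ f = 0)
    (h : (P.complex.linearYonedaObj S Y).iCycles n z = f) :
    P.cyclesToExt Y n z = P.extMk f (n + 1) rfl hf := by
  subst h
  rfl

lemma exists_iCycles_eq (n : ℕ) (f : P.complex.X n ⟶ Y) (hf : P.complex.d (n + 1) n ≫ f = 0) :
    ∃ z, (P.complex.linearYonedaObj S Y).iCycles n z = f := by
  let k : ModuleCat.of S S ⟶ (P.complex.linearYonedaObj S Y).X n :=
    ModuleCat.ofHom (LinearMap.toSpanSingleton S (P.complex.X n ⟶ Y) f)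
  have hk : k ≫ (P.complex.linearYonedaObj S Y).d n (n + 1) = 0 := by
    ext
    exact (congrArg (P.complex.d (n + 1) n ≫ ·) (one_smul S f)).trans hf
  refine ⟨(P.complex.linearYonedaObj S Y).liftCycles k (n + 1) (by simp) hk (1 : S), ?_⟩
  have h := congrArg (fun f => f.hom (1 : S))
    ((P.complex.linearYonedaObj S Y).liftCycles_i k (n + 1) (by simp) hk)
  exact h.trans (one_smul S f)

lemma cyclesToExt_surjective (n : ℕ) : Function.Surjective (P.cyclesToExt Y n) := by
  intro e
  obtain ⟨f, hf, rfl⟩ := P.extMk_surjective e (n + 1) rfl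
  obtain ⟨z, hz⟩ := P.exists_iCycles_eq n f hf
  exact ⟨z, P.cyclesToExt_apply n z f hf hz⟩

lemma toCycles_comp_cyclesToExt (Y : ModuleCat.{u} S) (m n : ℕ)
    (h : (ComplexShape.up ℕ).prev n = m) :
    (P.complex.linearYonedaObj S Y).toCycles m n ≫ P.cyclesToExt Y n = 0 := by
  obtain _ | n := n
  · rw [HomologicalComplex.toCycles_eq_zero _ (by simp), Limits.zero_comp]
  obtain rfl : n = m := by simpa using h
  ext g
  have hg : (P.complex.linearYonedaObj S Y).iCycles (n + 1)
      ((P.complex.linearYonedaObj S Y).toCycles n (n + 1) g) =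
        P.complex.d (n + 1) n ≫ (show P.complex.X n ⟶ Y from g) :=
    congrArg (fun f => f.hom g) ((P.complex.linearYonedaObj S Y).toCycles_i n (n + 1))
  exact (P.cyclesToExt_apply (n + 1) _ _
    (by rw [P.complex.d_comp_d_assoc, Limits.zero_comp]) hg).trans
    ((P.extMk_eq_zero_iff _ _ rfl _ n rfl).2 ⟨g, rfl⟩)

/-- The comparison map from the `Ext` defined by derived functors. -/
noncomputable def toExt (Y : ModuleCat.{u} S) (n : ℕ) :
    ((_root_.Ext S (ModuleCat.{u} S) n).obj (op X)).obj Y ⟶ ModuleCat.of S (Abelian.Ext X Y n) :=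
  (P.isoExt n Y).hom ≫ ((P.complex.linearYonedaObj S Y).homologyIsCokernel _ n rfl).desc
    (Limits.CokernelCofork.ofπ (P.cyclesToExt Y n) (P.toCycles_comp_cyclesToExt Y _ n rfl))

lemma homologyπ_toExt (n : ℕ) : (P.complex.linearYonedaObj S Y).homologyπ n ≫
      (P.isoExt n Y).inv ≫ P.toExt Y n = P.cyclesToExt Y n := by
  rw [toExt, Iso.inv_hom_id_assoc]
  exact ((P.complex.linearYonedaObj S Y).homologyIsCokernel _ n rfl).fac _
    Limits.WalkingParallelPair.one

lemma toExt_surjective (n : ℕ) : Function.Surjective (P.toExt Y n) := by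
  intro e
  obtain ⟨z, rfl⟩ := P.cyclesToExt_surjective n e
  rw [← homologyπ_toExt]
  exact ⟨_, rfl⟩

lemma toExt_naturality {X' : ModuleCat.{u} S} (P' : ProjectiveResolution X') (g : X' ⟶ X) (n : ℕ)
    (e : ((_root_.Ext S (ModuleCat.{u} S) n).obj (op X)).obj Y) :
    P'.toExt Y n (((_root_.Ext S (ModuleCat.{u} S) n).map g.op).app Y e) =
      (Ext.mk₀ g).comp (show Abelian.Ext X Y n from P.toExt Y n e) (zero_add n) := by
  let φ : Hom P' P g := ⟨lift g P' P, by rw [lift_commutes_zero]; simp⟩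
  have hfac : ((P.complex.linearYonedaObj S Y).homologyπ n ≫ (P.isoExt n Y).inv) ≫
      ((_root_.Ext S (ModuleCat.{u} S) n).map g.op).app Y ≫ P'.toExt Y n =
        HomologicalComplex.cyclesMap (ChainComplex.linearYonedaMap φ.hom Y) n ≫
          P'.cyclesToExt Y n := by
    rw [← homologyπ_toExt, ← HomologicalComplex.homologyπ_naturality_assoc, Category.assoc]
    congr 1
    rw [Iso.inv_comp_eq, ← Category.assoc, ← Category.assoc,
      ← isoExt_naturality]
    exact congrArg (· ≫ P'.toExt Y n) ((Iso.eq_comp_inv _).2 rfl)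
  obtain ⟨z, rfl⟩ : ∃ z,
      ((P.complex.linearYonedaObj S Y).homologyπ n ≫ (P.isoExt n Y).inv) z = e :=
    (ModuleCat.epi_iff_surjective _).1 (epi_comp _ _) e
  obtain ⟨f, hf⟩ : ∃ f : P.complex.X n ⟶ Y, (P.complex.linearYonedaObj S Y).iCycles n z = f :=
    ⟨_, rfl⟩
  have hdf : P.complex.d (n + 1) n ≫ f = 0 := by
    rw [← hf]
    exact congrArg (fun f => f.hom z) ((P.complex.linearYonedaObj S Y).iCycles_d n (n + 1))
  have h1 : P.toExt Y n (((P.complex.linearYonedaObj S Y).homologyπ n ≫ (P.isoExt n Y).inv) z) =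
      P.extMk f (n + 1) rfl hdf :=
    (congrArg (fun f => f.hom z) (P.homologyπ_toExt (Y := Y) n)).trans
      (P.cyclesToExt_apply n z f hdf hf)
  have h2 := congrArg (fun f => f.hom z)
    (HomologicalComplex.cyclesMap_i (ChainComplex.linearYonedaMap φ.hom Y) n)
  refine (congrArg (fun f => f.hom z) hfac).trans ?_
  refine Eq.trans ?_
    (congrArg (fun x : Abelian.Ext X Y n => (Ext.mk₀ g).comp x (zero_add n)) h1.symm)
  dsimp only
  rw [mk₀_comp_extMk f (n + 1) rfl hdf φ]
  refine P'.cyclesToExt_apply n _ _ _ (h2.trans ?_)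
  exact congrArg (φ.hom.f n ≫ ·) hf

end CategoryTheory.ProjectiveResolution

/-- The comparison maps form a cocone on the system defining local cohomology. -/
noncomputable def LC.cocone (I : Ideal S) (i : ℕ) (A : ModuleCat.{u} S) :
    Limits.Cocone (localCohomology.diagram (localCohomology.idealPowersDiagram I) i ⋙
      (evaluation _ _).obj A) where
  pt := ModuleCat.of S (ColimExt (powSystem I) i A)
  ι :=
    { app := fun t => (projectiveResolution ((powSystem I).obj t.unop)).toExt A i ≫
        ModuleCat.ofHom (ColimExt.of (powSystem I) i A t.unop.unop)
      naturality := fun t t' f => by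
        ext e
        have h := (projectiveResolution ((powSystem I).obj t.unop)).toExt_naturality
          (projectiveResolution ((powSystem I).obj t'.unop)) ((powSystem I).map f.unop) i e
        exact (congrArg (ColimExt.of (powSystem I) i A t'.unop.unop) h).trans
          (ColimExt.of_transition (powSystem I) (leOfHom f.unop.unop) _) }

/-- The local cohomology of Mathlib surjects onto the direct limit of the modules `Ext`. -/
lemma LC.exists_surjective (I : Ideal S) (i : ℕ) (A : ModuleCat.{u} S) :
    ∃ f : (localCohomology I i).obj A →ₗ[S] ColimExt (powSystem I) i A, Function.Surjective f := by
  have := localCohomology.hasColimitDiagram.{u, 0} (localCohomology.idealPowersDiagram I) i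
  let G := localCohomology.diagram (localCohomology.idealPowersDiagram I) i
  let e : (localCohomology I i).obj A ≅ Limits.colimit (G ⋙ (evaluation _ _).obj A) :=
    preservesColimitIso ((evaluation _ _).obj A) G
  refine ⟨(e.hom ≫ Limits.colimit.desc _ (cocone I i A)).hom, fun z => ?_⟩
  obtain ⟨t, x, rfl⟩ := ColimExt.exists_of _ z
  obtain ⟨y, rfl⟩ := (projectiveResolution ((powSystem I).obj (op t))).toExt_surjective i x
  refine ⟨e.inv (Limits.colimit.ι (G ⋙ (evaluation _ _).obj A) (op (op t)) y), ?_⟩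
  have h : Limits.colimit.ι (G ⋙ (evaluation _ _).obj A) (op (op t)) ≫ e.inv ≫ e.hom ≫
      Limits.colimit.desc _ (cocone I i A) = (cocone I i A).ι.app (op (op t)) := by
    rw [Iso.inv_hom_id_assoc, Limits.colimit.ι_desc]
  exact congrArg (fun f => f.hom y) h

end Comparison

section Fiber

variable {R S : Type u} [CommRing R] [CommRing S] [IsLocalRing R] [Algebra R S]

lemma isNoetherian_iff_isArtinian_of_map_maximalIdeal_smul {N : Type u} [AddCommGroup N]
    [Module R N] [Module S N] [IsScalarTower R S N]
    (hN : ∀ s ∈ (maximalIdeal R).map (algebraMap R S), ∀ n : N, s • n = 0) :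
    IsNoetherian R N ↔ IsArtinian R N :=
  isNoetherian_iff_isArtinian_of_maximalIdeal_smul fun a ha n => by
    rw [← algebraMap_smul S a n]
    exact hN _ (Ideal.mem_map_of_mem _ ha) n

lemma subsingleton_of_isArtinian_of_smul_surjective [IsLocalRing S] {N : Type u} [AddCommGroup N]
    [Module R N] [Module S N] [IsScalarTower R S N] [IsArtinian R N]
    (hN : ∀ s ∈ (maximalIdeal R).map (algebraMap R S), ∀ n : N, s • n = 0)
    {x : S} (hxm : x ∈ maximalIdeal S) (hx : ∀ n : N, ∃ n', x • n' = n) : Subsingleton N := by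
  have : IsNoetherian R N := (isNoetherian_iff_isArtinian_of_map_maximalIdeal_smul hN).2 ‹_›
  have : Module.Finite S N := Module.Finite.of_restrictScalars_finite R S N
  have h := Submodule.eq_bot_of_le_smul_of_le_jacobson_bot (maximalIdeal S) (⊤ : Submodule S N)
    Module.Finite.fg_top (fun n _ => by
      obtain ⟨n', rfl⟩ := hx n
      exact Submodule.smul_mem_smul hxm trivial) (maximalIdeal_le_jacobson ⊥)
  exact (Submodule.subsingleton_iff S).1 (subsingleton_of_bot_eq_top h.symm)

lemma powTorsion_quotient_eq_top [IsLocalRing S] [IsNoetherianRing S] {J : Ideal S}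
    (hJ : ringKrullDim (S ⧸ J) ≤ 0) : powTorsion (maximalIdeal S) (S ⧸ J) = ⊤ := by
  have hrad : maximalIdeal S ≤ J.radical := by
    rw [Ideal.radical_eq_sInf]
    refine le_sInf fun p hp => ?_
    have := hp.2
    have hle := (ringKrullDim_le_of_surjective (Ideal.Quotient.factor hp.1)
      (Ideal.Quotient.factor_surjective hp.1)).trans hJ
    exact (eq_maximalIdeal_of_ringKrullDim_eq_zero
      (le_antisymm hle ringKrullDim_nonneg_of_nontrivial)).ge
  obtain ⟨k, hk⟩ := Ideal.exists_pow_le_of_le_radical_of_fg hrad (IsNoetherian.noetherian _)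
  exact eq_top_iff.2 fun m _ => (mem_powTorsion _).2
    ⟨k, fun s hs => LC.quotient_smul_eq_zero (hk hs) m⟩

variable [IsLocalRing S] [IsNoetherianRing S]

/-- If the top local cohomology of a quotient of the closed fiber of `R → S` is Artinian over `R`,
then so is the quotient itself. -/
theorem isArtinian_quotient_of_isArtinian_LC {J : Ideal S}
    (hJ : (maximalIdeal R).map (algebraMap R S) ≤ J) {r : ℕ} (hr : ringKrullDim (S ⧸ J) = r)
    [Module R (LC (maximalIdeal S) r (S ⧸ J))]
    [IsScalarTower R S (LC (maximalIdeal S) r (S ⧸ J))]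
    [IsArtinian R (LC (maximalIdeal S) r (S ⧸ J))] : IsArtinian R (S ⧸ J) := by
  obtain rfl | hr0 := eq_or_ne r 0
  · have hsurj : Function.Surjective (LC.eval (maximalIdeal S) (S ⧸ J)) :=
      LinearMap.range_eq_top.1 ((LC.range_eval _).trans (powTorsion_quotient_eq_top hr.le))
    exact isArtinian_of_surjective _ ((LC.eval (maximalIdeal S) (S ⧸ J)).restrictScalars R) hsurj
  exfalso
  obtain ⟨p, hp, hJp, hge⟩ := exists_prime_le_ringKrullDim_quotient hr.ge
  have hpr : ringKrullDim (S ⧸ p) = r := le_antisymm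
    ((ringKrullDim_le_of_surjective (Ideal.Quotient.factor hJp)
      (Ideal.Quotient.factor_surjective hJp)).trans hr.le) hge
  have hpm : p < maximalIdeal S := (le_maximalIdeal hp.ne_top).lt_of_ne (by
    rintro rfl
    rw [ringKrullDim_quotient_maximalIdeal] at hpr
    exact hr0 (by exact_mod_cast hpr.symm))
  obtain ⟨x, hxm, hxp⟩ := SetLike.exists_of_lt hpm
  let f : (S ⧸ J) →ₗ[S] S ⧸ p := Submodule.factor hJp
  have hK : Module.supportDim S (LinearMap.ker f) < (r + 1 : ℕ) := by
    have h := Module.supportDim_le_of_injective (LinearMap.ker f).subtype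
      (LinearMap.ker f).subtype_injective
    rw [Module.supportDim_quotient_eq_ringKrullDim, hr] at h
    exact h.trans_lt (by exact_mod_cast r.lt_succ_self)
  have hf : Function.Surjective (LC.map (maximalIdeal S) r f) :=
    LC.map_surjective (Submodule.factor_surjective hJp) (LC.subsingleton_of_supportDim_lt _ _ hK)
  let _ : Module R (LC (maximalIdeal S) r (S ⧸ p)) := Module.compHom _ (algebraMap R S)
  have : IsScalarTower R S (LC (maximalIdeal S) r (S ⧸ p)) := .of_algebraMap_smul fun _ _ => rfl
  have : IsArtinian R (LC (maximalIdeal S) r (S ⧸ p)) :=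
    isArtinian_of_surjective _ ((LC.map (maximalIdeal S) r f).restrictScalars R) hf
  have := subsingleton_of_isArtinian_of_smul_surjective (R := R)
    (N := LC (maximalIdeal S) r (S ⧸ p))
    (fun s hs => LC.smul_eq_zero_of_forall (LC.quotient_smul_eq_zero (hJp (hJ hs)))) hxm
    (LC.smul_surjective (by rw [Module.supportDim_quotient_eq_ringKrullDim, hpr])
      (isSMulRegular_quotient_of_notMem hxp))
  exact not_nontrivial _ (LC.nontrivial_quotient_prime r p hpr)

end Fiber

end

/-- If `r = dim (S/mS)` and the top local cohomology module `H^r_n(S/mS)` is Artinian as an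
`R`-module by restriction of scalars along the flat local map `R → S`, then the `R`-module
`S/mS` has finite length. -/
theorem stmt2 (R S : Type u) [CommRing R] [CommRing S] [IsNoetherianRing R] [IsNoetherianRing S]
    [IsLocalRing R] [IsLocalRing S] [Algebra R S] [Module.Flat R S]
    [IsLocalHom (algebraMap R S)]
    (r : ℕ) (hr : ringKrullDim (S ⧸ (maximalIdeal R).map (algebraMap R S)) = r)
    (hart : IsArtinian R (RestrictScalars R S
      ((localCohomology (maximalIdeal S) r).obj
        (ModuleCat.of S (S ⧸ (maximalIdeal R).map (algebraMap R S)))))) :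
    IsFiniteLength R (S ⧸ (maximalIdeal R).map (algebraMap R S)) := by
  have hA : IsArtinian R (S ⧸ (maximalIdeal R).map (algebraMap R S)) := by
    obtain ⟨f, hf⟩ := LC.exists_surjective (maximalIdeal S) r
      (ModuleCat.of S (S ⧸ (maximalIdeal R).map (algebraMap R S)))
    let _ := Module.restrictScalars R S ((localCohomology (maximalIdeal S) r).obj
      (ModuleCat.of S (S ⧸ (maximalIdeal R).map (algebraMap R S))))
    have : IsScalarTower R S ((localCohomology (maximalIdeal S) r).obj
      (ModuleCat.of S (S ⧸ (maximalIdeal R).map (algebraMap R S)))) :=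
      .of_algebraMap_smul fun _ _ => rfl
    let _ := Module.restrictScalars R S
      (LC (maximalIdeal S) r (S ⧸ (maximalIdeal R).map (algebraMap R S)))
    have : IsScalarTower R S
        (LC (maximalIdeal S) r (S ⧸ (maximalIdeal R).map (algebraMap R S))) :=
      .of_algebraMap_smul fun _ _ => rfl
    have : IsArtinian R ((localCohomology (maximalIdeal S) r).obj
      (ModuleCat.of S (S ⧸ (maximalIdeal R).map (algebraMap R S)))) := hart
    have : IsArtinian R (LC (maximalIdeal S) r (S ⧸ (maximalIdeal R).map (algebraMap R S))) :=
      isArtinian_of_surjective _ (f.restrictScalars R) hf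
    exact isArtinian_quotient_of_isArtinian_LC le_rfl hr
  exact isFiniteLength_iff_isNoetherian_isArtinian.2
    ⟨(isNoetherian_iff_isArtinian_of_map_maximalIdeal_smul fun _ hs =>
      LC.quotient_smul_eq_zero hs).2 hA, hA⟩
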